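/- Let Σ be a positive-definite symmetric d × d real matrix with largest eigenvalue λ₁ attained by the unit eigenvector v₁, and let S be distributed according to the centered multivariate Gaussian N(0, Σ) on ℝ^d. Fix r > 0 and σ₀ > 0. Then for every unit vector u ∈ ℝ^d, E[ 4r·|⟪u, S⟫| / (σ₀·√(2·(‖S‖² + r²)² + 8·r²·⟪u, S⟫²)) ] ≤ E[ 4r·|⟪v₁, S⟫| / (σ₀·√(2·(‖S‖² + r²)² + 8·r²·⟪v₁, S⟫²)) ]. -/

import Mathlib

open MeasureTheory ProbabilityTheory
open scoped RealInnerProductSpace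

/-- The centered multivariate Gaussian measure `N(0, Σ)` on `EuclideanSpace ℝ (Fin d)`
with positive-definite covariance matrix `Σ`, defined via its Lebesgue density
`x ↦ ((2π)^d det Σ)^(-1/2) exp(-(1/2) ⟪x, Σ⁻¹ x⟫)`. -/
noncomputable def multivariateGaussian {d : ℕ} (S : Matrix (Fin d) (Fin d) ℝ) :
    Measure (EuclideanSpace ℝ (Fin d)) :=
  volume.withDensity fun x =>
    ENNReal.ofReal ((Real.sqrt ((2 * Real.pi) ^ d * S.det))⁻¹ *
      Real.exp (-(1 / 2) * ⟪x, Matrix.toEuclideanLin S⁻¹ x⟫))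

namespace Stmt8Aux

/-- The integrand as a function of `t = ⟪u, s⟫` and `q = ‖s‖² + r²`. -/
noncomputable def gfun (r σ₀ t q : ℝ) : ℝ :=
  4 * r * |t| / (σ₀ * Real.sqrt (2 * q ^ 2 + 8 * r ^ 2 * t ^ 2))

lemma gfun_mono {r σ₀ q t t' : ℝ} (hr : 0 < r) (hσ : 0 < σ₀) (hq : 0 < q)
    (h : t ^ 2 ≤ t' ^ 2) : gfun r σ₀ t q ≤ gfun r σ₀ t' q := by
  unfold gfun
  have h1 : 0 < Real.sqrt (2 * q ^ 2 + 8 * r ^ 2 * t ^ 2) := Real.sqrt_pos.2 (by positivity)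
  have h2 : 0 < Real.sqrt (2 * q ^ 2 + 8 * r ^ 2 * t' ^ 2) := Real.sqrt_pos.2 (by positivity)
  rw [div_le_div_iff₀ (by positivity) (by positivity)]
  have key : |t| * Real.sqrt (2 * q ^ 2 + 8 * r ^ 2 * t' ^ 2) ≤
      |t'| * Real.sqrt (2 * q ^ 2 + 8 * r ^ 2 * t ^ 2) := by
    rw [← Real.sqrt_sq_eq_abs, ← Real.sqrt_sq_eq_abs, ← Real.sqrt_mul (sq_nonneg _),
      ← Real.sqrt_mul (sq_nonneg _)]
    apply Real.sqrt_le_sqrt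
    nlinarith [mul_le_mul_of_nonneg_right h (sq_nonneg q)]
  have : 0 ≤ 4 * r * σ₀ := by positivity
  nlinarith [mul_le_mul_of_nonneg_left key this]

lemma gfun_nonneg {r σ₀ q t : ℝ} (hr : 0 < r) (hσ : 0 < σ₀) : 0 ≤ gfun r σ₀ t q := by
  unfold gfun; positivity

lemma gfun_le {r σ₀ q t : ℝ} (hr : 0 < r) (hσ : 0 < σ₀) (hq : 0 < q) :
    gfun r σ₀ t q ≤ 4 / σ₀ := by
  unfold gfun
  have h1 : 0 < Real.sqrt (2 * q ^ 2 + 8 * r ^ 2 * t ^ 2) := Real.sqrt_pos.2 (by positivity)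
  rw [div_le_div_iff₀ (by positivity) (by positivity)]
  have key : r * |t| ≤ Real.sqrt (2 * q ^ 2 + 8 * r ^ 2 * t ^ 2) := by
    apply Real.le_sqrt_of_sq_le
    rw [mul_pow, sq_abs]
    nlinarith [sq_nonneg q, mul_nonneg (sq_nonneg r) (sq_nonneg t)]
  nlinarith [mul_le_mul_of_nonneg_left key hσ.le]

variable {E : Type*} [NormedAddCommGroup E] [InnerProductSpace ℝ E] [FiniteDimensional ℝ E]
  [MeasurableSpace E] [BorelSpace E]

lemma gfun_cont {r σ₀ : ℝ} (hr : 0 < r) (hσ : 0 < σ₀) :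
    Continuous (fun p : E × E => gfun r σ₀ ⟪p.1, p.2⟫ (‖p.2‖ ^ 2 + r ^ 2)) := by
  unfold gfun
  refine Continuous.div (by fun_prop) (by fun_prop) (fun p => ?_)
  have h1 : 0 < Real.sqrt (2 * (‖p.2‖ ^ 2 + r ^ 2) ^ 2 + 8 * r ^ 2 * ⟪p.1, p.2⟫ ^ 2) :=
    Real.sqrt_pos.2 (by positivity)
  positivity

/-- The objective, as an integral against an unspecified density `f`. -/
noncomputable def Fobj (r σ₀ : ℝ) (f : E → ℝ) (u : E) : ℝ :=
  ∫ s, f s * gfun r σ₀ ⟪u, s⟫ (‖s‖ ^ 2 + r ^ 2)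

lemma integrable_prod {r σ₀ : ℝ} (hr : 0 < r) (hσ : 0 < σ₀) {f : E → ℝ}
    (hf : Integrable f) (u : E) :
    Integrable (fun s => f s * gfun r σ₀ ⟪u, s⟫ (‖s‖ ^ 2 + r ^ 2)) := by
  refine Integrable.mul_bdd (c := 4 / σ₀) hf ?_ ?_
  · exact ((gfun_cont hr hσ).comp (by fun_prop : Continuous fun s : E => (u, s))).aestronglyMeasurable
  · refine Filter.Eventually.of_forall (fun s => ?_)
    rw [Real.norm_of_nonneg (gfun_nonneg hr hσ)]
    exact gfun_le hr hσ (by positivity)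

lemma Fobj_cont {r σ₀ : ℝ} (hr : 0 < r) (hσ : 0 < σ₀) {f : E → ℝ}
    (hf : Integrable f) : Continuous (Fobj r σ₀ f) := by
  unfold Fobj
  refine continuous_of_dominated (bound := fun s => |f s| * (4 / σ₀))
    (fun u => (integrable_prod hr hσ hf u).aestronglyMeasurable) (fun u => ?_)
    (hf.abs.mul_const _) ?_
  · refine Filter.Eventually.of_forall (fun s => ?_)
    rw [norm_mul, Real.norm_of_nonneg (gfun_nonneg hr hσ), Real.norm_eq_abs]
    exact mul_le_mul_of_nonneg_left (gfun_le hr hσ (by positivity)) (abs_nonneg _)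
  · refine Filter.Eventually.of_forall (fun s => ?_)
    exact continuous_const.mul
      ((gfun_cont hr hσ).comp (by fun_prop : Continuous fun u : E => (u, s)))

/-- Reflection comparison for a general density. -/
lemma Fobj_reflect {r σ₀ : ℝ} (hr : 0 < r) (hσ : 0 < σ₀) {f : E → ℝ}
    (hf : Integrable f) (K : Submodule ℝ E) (u : E)
    (hle : ∀ s, (⟪u, s⟫ ^ 2 ≤ ⟪u, K.reflection s⟫ ^ 2 ∧ f (K.reflection s) ≤ f s) ∨
      (⟪u, K.reflection s⟫ ^ 2 ≤ ⟪u, s⟫ ^ 2 ∧ f s ≤ f (K.reflection s))) :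
    Fobj r σ₀ f u ≤ Fobj r σ₀ f (K.reflection u) := by
  set H := K.reflection with hH
  have hHH : ∀ s, H (H s) = s := fun s => K.reflection_reflection s
  have hinn : ∀ s, ⟪H u, s⟫ = ⟪u, H s⟫ := fun s => by
    rw [← H.inner_map_map u (H s), hHH]
  set G : E → ℝ := fun s => gfun r σ₀ ⟪u, s⟫ (‖s‖ ^ 2 + r ^ 2) with hG
  have hGH : ∀ s, gfun r σ₀ ⟪H u, s⟫ (‖s‖ ^ 2 + r ^ 2) = G (H s) := fun s => by
    simp [hG, hinn]
  have mp : MeasurePreserving H (volume : Measure E) volume := H.measurePreserving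
  have me : MeasurableEmbedding H := H.toHomeomorph.measurableEmbedding
  have i1 : Integrable (fun s => f s * G s) := integrable_prod hr hσ hf u
  have i2 : Integrable (fun s => f s * G (H s)) := by
    simpa only [hGH] using integrable_prod hr hσ hf (H u)
  have i3 : Integrable (fun s => f (H s) * G (H s)) := (mp.integrable_comp_emb me).2 i1
  have i4 : Integrable (fun s => f (H s) * G s) := by
    simpa only [Function.comp_def, hHH] using (mp.integrable_comp_emb me).2 i2
  have e3 : ∫ s, f (H s) * G (H s) = ∫ s, f s * G s :=
    mp.integral_comp me (fun s => f s * G s)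
  have e4 : ∫ s, f (H s) * G s = ∫ s, f s * G (H s) := by
    simpa only [hHH] using mp.integral_comp me (fun s => f s * G (H s))
  have hneg : ∫ s, ((f s * G s + f (H s) * G (H s)) - (f s * G (H s) + f (H s) * G s)) ≤ 0 := by
    apply integral_nonpos
    intro s
    have hn : ‖H s‖ = ‖s‖ := H.norm_map s
    have : (f s - f (H s)) * (G s - G (H s)) ≤ 0 := by
      rcases hle s with ⟨h1, h2⟩ | ⟨h1, h2⟩
      · refine mul_nonpos_of_nonneg_of_nonpos (by linarith) ?_
        have : G s ≤ G (H s) := by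
          simp only [hG, hn]; exact gfun_mono hr hσ (by positivity) h1
        linarith
      · refine mul_nonpos_of_nonpos_of_nonneg (by linarith) ?_
        have : G (H s) ≤ G s := by
          simp only [hG, hn]; exact gfun_mono hr hσ (by positivity) h1
        linarith
    simp only [Pi.zero_apply]
    linarith
  rw [integral_sub (f := fun s => f s * G s + f (H s) * G (H s))
    (g := fun s => f s * G (H s) + f (H s) * G s) (i1.add i3) (i2.add i4), integral_add i1 i3, integral_add i2 i4, e3, e4] at hneg
  have : Fobj r σ₀ f (H u) = ∫ s, f s * G (H s) := by
    simp only [Fobj, hGH]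
  rw [this]
  change ∫ s, f s * G s ≤ _
  linarith

lemma reflection_formula (w s : E) (hw : w ≠ 0) :
    (ℝ ∙ w)ᗮ.reflection s = s - (2 * (⟪w, s⟫ / ‖w‖ ^ 2)) • w := by
  rw [Submodule.reflection_orthogonal_apply, Submodule.reflection_singleton_apply]
  simp only [RCLike.ofReal_real_eq_id, id, neg_sub, smul_smul, two_smul, two_mul, add_smul]

lemma Fobj_gauss_reflect {r σ₀ C : ℝ} (hr : 0 < r) (hσ : 0 < σ₀) (hC : 0 ≤ C) (P : E →ₗ[ℝ] E)
    (hP : P.IsSymmetric)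
    (hf : Integrable fun s => C * Real.exp (-(1 / 2) * ⟪s, P s⟫)) (u w : E) (hw : w ≠ 0)
    (μ κ : ℝ) (hPw : P w = μ • w + κ • u) (hκ : 0 ≤ κ * ⟪u, w⟫) :
    Fobj r σ₀ (fun s => C * Real.exp (-(1 / 2) * ⟪s, P s⟫)) u ≤
      Fobj r σ₀ (fun s => C * Real.exp (-(1 / 2) * ⟪s, P s⟫)) ((ℝ ∙ w)ᗮ.reflection u) := by
  refine Fobj_reflect hr hσ hf _ u (fun s => ?_)
  have hw2 : (0:ℝ) < ‖w‖ ^ 2 := by positivity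
  obtain ⟨α, hα⟩ : ∃ α, α = ⟪w, s⟫ / ‖w‖ ^ 2 := ⟨_, rfl⟩
  have hws : ⟪w, s⟫ = α * ‖w‖ ^ 2 := by rw [hα]; field_simp
  rw [reflection_formula w s hw, ← hα]
  have d1 : ⟪u, s⟫ ^ 2 - ⟪u, s - (2 * α) • w⟫ ^ 2 =
      4 * α * ⟪u, w⟫ * (⟪u, s⟫ - α * ⟪u, w⟫) := by
    simp only [inner_sub_right, inner_smul_right]; ring
  have d2 : ⟪s, P s⟫ - ⟪s - (2 * α) • w, P (s - (2 * α) • w)⟫ =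
      4 * α * κ * (⟪u, s⟫ - α * ⟪u, w⟫) := by
    have e1 : ⟪w, P s⟫ = ⟪P w, s⟫ := (hP w s).symm
    have e2 : ⟪s, P w⟫ = ⟪P w, s⟫ := real_inner_comm _ _
    have e3 : ⟪w, P w⟫ = ⟪P w, w⟫ := real_inner_comm _ _
    simp only [map_sub, map_smul, inner_sub_right, inner_sub_left, inner_smul_right,
      inner_smul_left, e1, e2, e3, conj_trivial]
    rw [hPw]
    simp only [inner_add_left, inner_smul_left, conj_trivial, hws, real_inner_self_eq_norm_sq]
    ring
  set a := ⟪s, P s⟫ with ha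
  set b := ⟪s - (2 * α) • w, P (s - (2 * α) • w)⟫ with hb
  have hprod : 0 ≤ (⟪u, s⟫ ^ 2 - ⟪u, s - (2 * α) • w⟫ ^ 2) * (a - b) := by
    rw [d1, d2]
    have : 4 * α * ⟪u, w⟫ * (⟪u, s⟫ - α * ⟪u, w⟫) * (4 * α * κ * (⟪u, s⟫ - α * ⟪u, w⟫)) =
      (κ * ⟪u, w⟫) * (4 * α * (⟪u, s⟫ - α * ⟪u, w⟫)) ^ 2 := by ring
    rw [this]; positivity
  have hexp : ∀ x y : ℝ, x ≤ y → C * Real.exp (-(1 / 2) * y) ≤ C * Real.exp (-(1 / 2) * x) := by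
    intro x y hxy
    exact mul_le_mul_of_nonneg_left (Real.exp_le_exp.2 (by linarith)) hC
  rcases mul_nonneg_iff.1 hprod with ⟨h1, h2⟩ | ⟨h1, h2⟩
  · exact Or.inr ⟨by linarith, hexp _ _ (by linarith)⟩
  · exact Or.inl ⟨by linarith, hexp _ _ (by linarith)⟩

/-- Spectral inequality, with equality case. -/
lemma spectral {L : E →ₗ[ℝ] E} (hL : L.IsSymmetric) (hpos : ∀ x, x ≠ 0 → 0 < ⟪x, L x⟫)
    {lam : ℝ} (hmax : ∀ (μ : ℝ) (x : E), x ≠ 0 → L x = μ • x → μ ≤ lam) (y : E) :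
    ‖L y‖ ^ 2 ≤ lam * ⟪y, L y⟫ ∧ (lam * ⟪y, L y⟫ ≤ ‖L y‖ ^ 2 → L y = lam • y) := by
  set b := hL.eigenvectorBasis (n := Module.finrank ℝ E) rfl with hb
  set m := hL.eigenvalues (n := Module.finrank ℝ E) rfl with hm
  have hbe : ∀ i, L (b i) = m i • b i := fun i => by
    exact hL.apply_eigenvectorBasis rfl i
  have hb1 : ∀ i, ‖b i‖ = 1 := fun i => b.orthonormal.1 i
  have hb0 : ∀ i, b i ≠ 0 := fun i h => by simpa [h] using hb1 i
  have hmpos : ∀ i, 0 < m i := fun i => by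
    have := hpos _ (hb0 i)
    rw [hbe, inner_smul_right, real_inner_self_eq_norm_sq, hb1] at this
    simpa using this
  have hmle : ∀ i, m i ≤ lam := fun i => hmax _ _ (hb0 i) (hbe i)
  have hc : ∀ i, ⟪b i, L y⟫ = m i * ⟪b i, y⟫ := fun i => by
    rw [← hL (b i) y, hbe, inner_smul_left, conj_trivial]
  have s1 : ⟪y, L y⟫ = ∑ i, m i * ⟪b i, y⟫ ^ 2 := by
    rw [← b.sum_inner_mul_inner y (L y)]
    refine Finset.sum_congr rfl fun i _ => ?_
    rw [hc, real_inner_comm]; ring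
  have s2 : ‖L y‖ ^ 2 = ∑ i, m i ^ 2 * ⟪b i, y⟫ ^ 2 := by
    rw [← real_inner_self_eq_norm_sq, ← b.sum_inner_mul_inner (L y) (L y)]
    refine Finset.sum_congr rfl fun i _ => ?_
    rw [real_inner_comm, hc]; ring
  have s3 : lam * ⟪y, L y⟫ - ‖L y‖ ^ 2 = ∑ i, m i * (lam - m i) * ⟪b i, y⟫ ^ 2 := by
    rw [s1, s2, Finset.mul_sum, ← Finset.sum_sub_distrib]
    refine Finset.sum_congr rfl fun i _ => ?_
    ring
  have hnn : ∀ i ∈ Finset.univ, 0 ≤ m i * (lam - m i) * ⟪b i, y⟫ ^ 2 := fun i _ =>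
    mul_nonneg (mul_nonneg (hmpos i).le (by linarith [hmle i])) (sq_nonneg _)
  refine ⟨by linarith [Finset.sum_nonneg hnn], fun hle => ?_⟩
  have h0 : ∑ i, m i * (lam - m i) * ⟪b i, y⟫ ^ 2 = 0 :=
    le_antisymm (by linarith) (Finset.sum_nonneg hnn)
  rw [Finset.sum_eq_zero_iff_of_nonneg hnn] at h0
  apply b.repr.injective
  ext i
  rw [b.repr_apply_apply, b.repr_apply_apply, hc, inner_smul_right]
  have := h0 i (Finset.mem_univ i)
  rcases mul_eq_zero.1 this with h | h
  · rcases mul_eq_zero.1 h with h | h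
    · exact absurd h (hmpos i).ne'
    · rw [show m i = lam by linarith]
  · rw [pow_eq_zero_iff two_ne_zero] at h
    rw [h]; simp

theorem main {r σ₀ C : ℝ} (hr : 0 < r) (hσ : 0 < σ₀) (hC : 0 ≤ C) (L P : E →ₗ[ℝ] E)
    (hL : L.IsSymmetric) (hpos : ∀ x, x ≠ 0 → 0 < ⟪x, L x⟫)
    (hPL : ∀ x, P (L x) = x) (hLP : ∀ x, L (P x) = x)
    {lam : ℝ} (hmax : ∀ (μ : ℝ) (x : E), x ≠ 0 → L x = μ • x → μ ≤ lam)
    (v : E) (hv : ‖v‖ = 1) (heig : L v = lam • v) (u : E) (hu : ‖u‖ = 1) :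
    Fobj r σ₀ (fun s => C * Real.exp (-(1 / 2) * ⟪s, P s⟫)) u ≤
      Fobj r σ₀ (fun s => C * Real.exp (-(1 / 2) * ⟪s, P s⟫)) v := by
  have hP : P.IsSymmetric := fun x y => by
    conv_lhs => rw [← hLP y]
    conv_rhs => rw [← hLP x]
    exact (hL _ _).symm
  have hv0 : v ≠ 0 := fun h => by simp [h] at hv
  have hlam : 0 < lam := by
    have := hpos v hv0
    rw [heig, inner_smul_right, real_inner_self_eq_norm_sq, hv] at this
    simpa using this
  have hPc : Continuous P := P.continuous_of_finiteDimensional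
  have hf : Integrable fun s : E => C * Real.exp (-(1 / 2) * ⟪s, P s⟫) := by
    have h1 : Integrable fun s : E => Real.exp (-(1 / (2 * lam)) * ‖s‖ ^ 2) := by
      have := (GaussianFourier.integrable_cexp_neg_mul_sq_norm_add (V := E)
        (b := ((1 / (2 * lam) : ℝ) : ℂ)) (by rw [Complex.ofReal_re]; positivity) 0 0).norm
      refine this.congr (Filter.Eventually.of_forall fun s => ?_)
      simp only [Complex.norm_exp]
      congr 1
      simp [← Complex.ofReal_pow]
    refine Integrable.const_mul (h1.mono' (by fun_prop) (Filter.Eventually.of_forall fun s => ?_)) C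
    rw [Real.norm_eq_abs, Real.abs_exp]
    apply Real.exp_le_exp.2
    have := (spectral hL hpos hmax (P s)).1
    rw [hLP, real_inner_comm] at this
    have h2 : ‖s‖ ^ 2 / lam ≤ ⟪s, P s⟫ := by
      rw [div_le_iff₀ hlam]; linarith
    have h3 : 1 / (2 * lam) * ‖s‖ ^ 2 = 1 / 2 * (‖s‖ ^ 2 / lam) := by field_simp
    linarith
  set f : E → ℝ := fun s => C * Real.exp (-(1 / 2) * ⟪s, P s⟫) with hfdef
  have hcont : Continuous (Fobj r σ₀ f) := Fobj_cont hr hσ hf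
  -- the case of a vector not orthogonal to `v`
  have main1 : ∀ u : E, ‖u‖ = 1 → ⟪v, u⟫ ≠ 0 → Fobj r σ₀ f u ≤ Fobj r σ₀ f v := by
    intro u0 hu0 hne
    let K : Set E := Metric.sphere 0 1 ∩ {x | Fobj r σ₀ f u0 ≤ Fobj r σ₀ f x}
    have hK : IsCompact K := (isCompact_sphere 0 1).inter_right (isClosed_le continuous_const hcont)
    have hK0 : u0 ∈ K := ⟨by simpa using hu0, le_refl (Fobj r σ₀ f u0)⟩
    obtain ⟨x, hxK, hxmax⟩ := hK.exists_isMaxOn ⟨u0, hK0⟩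
      (f := fun x => ⟪v, x⟫ ^ 2) (by fun_prop)
    have hx1 : ‖x‖ = 1 := by simpa using hxK.1
    have hx2 : Fobj r σ₀ f u0 ≤ Fobj r σ₀ f x := hxK.2
    have hx0 : x ≠ 0 := fun h => by simp [h] at hx1
    have hvx : 0 < ⟪v, x⟫ ^ 2 := lt_of_lt_of_le (by positivity) (hxmax hK0)
    have hLx : L x ≠ 0 := fun h => by simpa [h] using hpos x hx0
    have hF := Fobj_gauss_reflect hr hσ hC P hP hf x (L x) hLx 0 1 (by simp [hPL])
      (by simpa using (hpos x hx0).le)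
    have hmem : (ℝ ∙ L x)ᗮ.reflection x ∈ K :=
      ⟨by simpa using hx1, hx2.trans hF⟩
    have hle := hxmax hmem
    simp only [Set.mem_setOf_eq] at hle
    have hN : 0 < ‖L x‖ ^ 2 := by positivity
    have hvL : ⟪v, L x⟫ = lam * ⟪v, x⟫ := by
      rw [← hL v x, heig, inner_smul_left, conj_trivial]
    obtain ⟨hsp1, hsp2⟩ := spectral hL hpos hmax x
    have hLxe : L x = lam • x := by
      apply hsp2
      rw [reflection_formula _ _ hLx, inner_sub_right, inner_smul_right, hvL,
        real_inner_comm x (L x)] at hle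
      set τ := lam * (⟪x, L x⟫ / ‖L x‖ ^ 2) with hτ
      have h1 : ⟪v, x⟫ ^ 2 * (1 - 2 * τ) ^ 2 ≤ ⟪v, x⟫ ^ 2 * 1 := by
        calc _ = (⟪v, x⟫ - 2 * (⟪x, L x⟫ / ‖L x‖ ^ 2) * (lam * ⟪v, x⟫)) ^ 2 := by
              rw [hτ]; ring
          _ ≤ _ := by rw [mul_one]; exact hle
      have h2 := le_of_mul_le_mul_left h1 hvx
      have h3 : τ ≤ 1 := by nlinarith
      rw [hτ, ← mul_div_assoc, div_le_one hN] at h3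
      exact h3
    by_cases hxv : x = v
    · rw [← hxv]; exact hx2
    have hPe : ∀ z, L z = lam • z → P z = lam⁻¹ • z := fun z hz => by
      have h := hPL z
      rw [hz, map_smul] at h
      conv_rhs => rw [← h]
      rw [smul_smul, inv_mul_cancel₀ hlam.ne', one_smul]
    have hF2 := Fobj_gauss_reflect hr hσ hC P hP hf x (x - v) (sub_ne_zero.2 hxv) lam⁻¹ 0
      (by rw [zero_smul, add_zero]; apply hPe; rw [map_sub, hLxe, heig, smul_sub]) (by simp)
    rw [Submodule.reflection_sub (hx1.trans hv.symm)] at hF2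
    exact hx2.trans hF2
  by_cases hne : ⟪v, u⟫ = 0
  · have hc2 : Continuous fun t : ℝ => Fobj r σ₀ f (Real.cos t • u + Real.sin t • v) :=
      hcont.comp (by fun_prop)
    have ht : Filter.Tendsto (fun t : ℝ => Fobj r σ₀ f (Real.cos t • u + Real.sin t • v))
        (nhdsWithin 0 (Set.Ioi 0)) (nhds (Fobj r σ₀ f u)) := by
      have := (hc2.tendsto 0).mono_left (nhdsWithin_le_nhds (s := Set.Ioi 0))
      simpa using this
    refine le_of_tendsto ht ?_
    filter_upwards [Ioo_mem_nhdsGT Real.pi_pos] with t ht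
    have hs : 0 < Real.sin t := Real.sin_pos_of_pos_of_lt_pi ht.1 ht.2
    have huv : ⟪u, v⟫ = 0 := by rw [real_inner_comm]; exact hne
    refine main1 _ ?_ ?_
    · have : ‖Real.cos t • u + Real.sin t • v‖ ^ 2 = 1 := by
        rw [norm_add_sq_real, inner_smul_left, inner_smul_right, huv, norm_smul, norm_smul, hu, hv]
        simp
      rw [← sq_eq_sq₀ (norm_nonneg _) zero_le_one, this, one_pow]
    · rw [inner_add_right, inner_smul_right, inner_smul_right, hne, real_inner_self_eq_norm_sq, hv]
      simpa using hs.ne'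
  · exact main1 u hu hne

end Stmt8Aux

/-- Let `Σ` be a positive-definite symmetric matrix whose largest eigenvalue `λ₁` is
attained by the unit eigenvector `v₁`, and let `S ~ N(0, Σ)`. For `r > 0`, `σ₀ > 0`,
and every unit vector `u`,
`E[4r |⟪u,S⟫| / (σ₀ √(2(‖S‖² + r²)² + 8r² ⟪u,S⟫²))]
  ≤ E[4r |⟪v₁,S⟫| / (σ₀ √(2(‖S‖² + r²)² + 8r² ⟪v₁,S⟫²))]`. -/
theorem stmt8 {d : ℕ} (S : Matrix (Fin d) (Fin d) ℝ)
    (hsymm : S.IsSymm) (hpd : S.PosDef)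
    (lam₁ : ℝ) (v₁ : EuclideanSpace ℝ (Fin d)) (hv₁ : ‖v₁‖ = 1)
    (heig : Matrix.toEuclideanLin S v₁ = lam₁ • v₁)
    (hmax : ∀ (μ : ℝ) (x : EuclideanSpace ℝ (Fin d)),
      x ≠ 0 → Matrix.toEuclideanLin S x = μ • x → μ ≤ lam₁)
    (r σ₀ : ℝ) (hr : 0 < r) (hσ₀ : 0 < σ₀)
    (u : EuclideanSpace ℝ (Fin d)) (hu : ‖u‖ = 1) :
    ∫ s, 4 * r * |⟪u, s⟫| /
        (σ₀ * Real.sqrt (2 * (‖s‖ ^ 2 + r ^ 2) ^ 2 + 8 * r ^ 2 * ⟪u, s⟫ ^ 2))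
        ∂(multivariateGaussian S) ≤
      ∫ s, 4 * r * |⟪v₁, s⟫| /
        (σ₀ * Real.sqrt (2 * (‖s‖ ^ 2 + r ^ 2) ^ 2 + 8 * r ^ 2 * ⟪v₁, s⟫ ^ 2))
        ∂(multivariateGaussian S) := by
  have hunit : IsUnit S.det := isUnit_iff_ne_zero.2 hpd.det_pos.ne'
  have hL : (Matrix.toEuclideanLin S).IsSymmetric :=
    Matrix.isSymmetric_toEuclideanLin_iff.2 hpd.isHermitian
  have hpos : ∀ x, x ≠ 0 → 0 < ⟪x, Matrix.toEuclideanLin S x⟫ := by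
    intro x hx
    have := hpd.dotProduct_mulVec_pos (x := x.ofLp) (by simpa using hx)
    simpa [EuclideanSpace.inner_eq_star_dotProduct, dotProduct_comm] using this
  have hPL : ∀ x, Matrix.toEuclideanLin S⁻¹ (Matrix.toEuclideanLin S x) = x := by
    intro x
    simp [Matrix.toEuclideanLin_apply, Matrix.mulVec_mulVec, Matrix.nonsing_inv_mul S hunit]
  have hLP : ∀ x, Matrix.toEuclideanLin S (Matrix.toEuclideanLin S⁻¹ x) = x := by
    intro x
    simp [Matrix.toEuclideanLin_apply, Matrix.mulVec_mulVec, Matrix.mul_nonsing_inv S hunit]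
  have hPc : Continuous (Matrix.toEuclideanLin S⁻¹) :=
    LinearMap.continuous_of_finiteDimensional _
  have hC : 0 ≤ (Real.sqrt ((2 * Real.pi) ^ d * S.det))⁻¹ := by positivity
  have key := Stmt8Aux.main hr hσ₀ hC (Matrix.toEuclideanLin S) (Matrix.toEuclideanLin S⁻¹)
    hL hpos hPL hLP hmax v₁ hv₁ heig u hu
  have conv : ∀ g : EuclideanSpace ℝ (Fin d) → ℝ, ∫ s, g s ∂(_root_.multivariateGaussian S) =
      ∫ s, ((Real.sqrt ((2 * Real.pi) ^ d * S.det))⁻¹ *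
        Real.exp (-(1 / 2) * ⟪s, Matrix.toEuclideanLin S⁻¹ s⟫)) * g s := by
    intro g
    unfold _root_.multivariateGaussian
    rw [integral_withDensity_eq_integral_toReal_smul
      (by exact Continuous.measurable (ENNReal.continuous_ofReal.comp (by fun_prop)))
      (Filter.Eventually.of_forall fun s => ENNReal.ofReal_lt_top)]
    refine integral_congr_ae (Filter.Eventually.of_forall fun s => ?_)
    simp only [smul_eq_mul]
    rw [ENNReal.toReal_ofReal (by positivity)]
  rw [conv, conv]
  exact key
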